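/- Let C > 0 be a constant. For every η > 0 there is n_0 such that for all n ≥ n_0 the following holds: for every m ≤ Cn, every deterministic online strategy of Builder, and every realization of the first m edges e_1, …, e_m for which Y_m ∪ Z_m ≠ ∅, the conditional probability (given e_1, …, e_m) that B_{τ_1} has an isolated vertex is at least (1 − η)·|Y_m| / (|Y_m| + |Z_m|). -/

import Mathlib

open Finset Filter

namespace RGP

/-- Number of edges of the complete graph on `n` vertices. -/
def numEdges (n : ℕ) : ℕ := n * (n - 1) / 2

/-- An edge of the complete graph on `Fin n` (an unordered pair of distinct vertices). -/
abbrev EdgeType (n : ℕ) := {e : Sym2 (Fin n) // ¬ e.IsDiag}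

/-- A uniformly random permutation of the edges of `K_n` is modelled by a bijection
`σ` between positions `Fin (numEdges n)` and edges; `σ i` is the edge `e_{i+1}`. -/
abbrev Ord (n : ℕ) := Fin (numEdges n) ≃ EdgeType n

/-- Degree of a vertex `v` in a set `S` of edges. -/
def deg {n : ℕ} (S : Finset (Sym2 (Fin n))) (v : Fin n) : ℕ :=
  (S.filter (fun e => v ∈ e)).card

/-- The edge set `{e_1, …, e_m}` of `G_{n,m}` in the random graph process `σ`. -/
def procEdges {n : ℕ} (σ : Ord n) (m : ℕ) : Finset (Sym2 (Fin n)) :=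
  (Finset.univ.filter (fun i : Fin (numEdges n) => (i : ℕ) < m)).image (fun i => (σ i).1)

/-- The hitting time `τ_k` for minimum degree at least `k`. -/
noncomputable def tau {n : ℕ} (k : ℕ) (σ : Ord n) : ℕ :=
  sInf {m | ∀ v : Fin n, k ≤ deg (procEdges σ m) v}

open scoped Classical in
/-- The probability of an event under the uniformly random edge ordering. -/
noncomputable def Pr {n : ℕ} (p : Ord n → Prop) : ℝ :=
  ((Finset.univ : Finset (Ord n)).filter p).card / (Fintype.card (Ord n) : ℝ)

/-- A deterministic online strategy: given the sequence of edges revealed so far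
(the last entry being the edge just revealed), decide whether to purchase it. -/
abbrev Strategy (n : ℕ) := List (Sym2 (Fin n)) → Bool

/-- The list of the first `i` revealed edges `e_1, …, e_i`. -/
def prefixList {n : ℕ} (σ : Ord n) (i : ℕ) : List (Sym2 (Fin n)) :=
  (List.range i).filterMap (fun j => if h : j < numEdges n then some (σ ⟨j, h⟩).1 else none)

/-- `buy st σ i` is the edge set of Builder's graph `B_i`: the edges purchased by the
strategy `st` among `e_1, …, e_i`. -/
def buy {n : ℕ} (st : Strategy n) (σ : Ord n) : ℕ → Finset (Sym2 (Fin n))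
  | 0 => ∅
  | i + 1 =>
    if h : i < numEdges n then
      if st (prefixList σ (i + 1)) then insert (σ ⟨i, h⟩).1 (buy st σ i)
      else buy st σ i
    else buy st σ i

end RGP

namespace RGP

/-- Builder's purchased edge set, as determined by the strategy `st`, after the list `L`
of edges has been revealed (the decision about the `i`-th edge depends on the prefix of
length `i`). -/
def buyList {n : ℕ} (st : Strategy n) (L : List (Sym2 (Fin n))) : Finset (Sym2 (Fin n)) :=
  ((List.range L.length).filterMap
    (fun i => if st (L.take (i + 1)) then L[i]? else none)).toFinset

/-- Conditional probability of `p` given `q` under the uniformly random edge ordering. -/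
noncomputable def CondPr {n : ℕ} (p q : Ord n → Prop) : ℝ :=
  Pr (fun σ => p σ ∧ q σ) / Pr q

end RGP

namespace RGP

open scoped Classical in
/-- First position (among the edges of `R`) at which `v` is touched. -/
noncomputable def T {n : ℕ} (R : Finset (EdgeType n)) (σ : Ord n) (v : Fin n) : ℕ∞ :=
  (R.filter (fun e => v ∈ e.1)).inf (fun e => (((σ.symm e : Fin (numEdges n)) : ℕ) : ℕ∞))

lemma T_le {n : ℕ} {R : Finset (EdgeType n)} {σ : Ord n} {v : Fin n} {e : EdgeType n}
    (he : e ∈ R) (hv : v ∈ e.1) : T R σ v ≤ ((σ.symm e : ℕ) : ℕ∞) := by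
  classical
  unfold T
  exact Finset.inf_le (f := fun e => (((σ.symm e : Fin (numEdges n)) : ℕ) : ℕ∞))
    (Finset.mem_filter.2 ⟨he, hv⟩)

lemma le_T {n : ℕ} {R : Finset (EdgeType n)} {σ : Ord n} {v : Fin n} {t : ℕ∞}
    (h : ∀ e ∈ R, v ∈ e.1 → t ≤ ((σ.symm e : ℕ) : ℕ∞)) : t ≤ T R σ v := by
  classical
  unfold T
  refine Finset.le_inf fun e he => ?_
  rw [Finset.mem_filter] at he
  exact h e he.1 he.2

lemma T_lt {n : ℕ} {R : Finset (EdgeType n)} {σ : Ord n} {v : Fin n} {t : ℕ∞}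
    (h : T R σ v < t) : ∃ e ∈ R, v ∈ e.1 ∧ ((σ.symm e : ℕ) : ℕ∞) < t := by
  by_contra! hc
  exact absurd (le_T hc) (not_le.2 h)

lemma T_attained {n : ℕ} {R : Finset (EdgeType n)} {σ : Ord n} {v : Fin n}
    (h : T R σ v ≠ ⊤) : ∃ e ∈ R, v ∈ e.1 ∧ T R σ v = ((σ.symm e : ℕ) : ℕ∞) := by
  classical
  have hne : (R.filter (fun e => v ∈ e.1)).Nonempty := by
    rw [Finset.nonempty_iff_ne_empty]
    intro h0
    apply h
    unfold T
    rw [h0]; simp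
  obtain ⟨e, he, h2⟩ := Finset.exists_mem_eq_inf _ hne
    (fun e => (((σ.symm e : Fin (numEdges n)) : ℕ) : ℕ∞))
  rw [Finset.mem_filter] at he
  exact ⟨e, he.1, he.2, h2⟩

lemma pos_inj {n : ℕ} {σ : Ord n} {e f : EdgeType n}
    (h : ((σ.symm e : ℕ) : ℕ∞) = ((σ.symm f : ℕ) : ℕ∞)) : e = f := by
  have h1 : (σ.symm e : ℕ) = (σ.symm f : ℕ) := by exact_mod_cast h
  exact σ.symm.injective (Fin.ext h1)

/-- the edge `vw` -/
def mkE {n : ℕ} (v w : Fin n) (h : v ≠ w) : EdgeType n := ⟨s(v, w), by simpa using h⟩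

/-- The vertex transposition acting on edges. -/
def mapE {n : ℕ} (y z : Fin n) (e : EdgeType n) : EdgeType n :=
  ⟨Sym2.map (Equiv.swap y z) e.1, by
    rw [Sym2.isDiag_map (Equiv.swap y z).injective]; exact e.2⟩

lemma mapE_mapE {n : ℕ} (y z : Fin n) (e : EdgeType n) : mapE y z (mapE y z e) = e := by
  apply Subtype.ext
  simp [mapE, Sym2.map_map]

lemma mem_mapE {n : ℕ} {y z v : Fin n} {e : EdgeType n} (h : v ∈ e.1) :
    Equiv.swap y z v ∈ (mapE y z e).1 := by
  simp only [mapE, Sym2.mem_map]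
  exact ⟨v, h, rfl⟩

open scoped Classical in
/-- The partial transposition. -/
noncomputable def phi {n : ℕ} (R : Finset (EdgeType n)) (y z : Fin n) (e : EdgeType n) :
    EdgeType n := if e ∈ R ∧ mapE y z e ∈ R then mapE y z e else e

lemma phi_invol {n : ℕ} (R : Finset (EdgeType n)) (y z : Fin n) :
    Function.Involutive (phi R y z) := by
  intro e
  by_cases h : e ∈ R ∧ mapE y z e ∈ R
  · simp [phi, h.1, h.2, mapE_mapE]
  · have : phi R y z e = e := by rw [phi, if_neg h]
    rw [this, this]

lemma phi_mem {n : ℕ} {R : Finset (EdgeType n)} {y z : Fin n} {e : EdgeType n} (he : e ∈ R) :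
    phi R y z e ∈ R := by
  unfold phi; split_ifs with h
  · exact h.2
  · exact he

lemma phi_not_mem {n : ℕ} {R : Finset (EdgeType n)} {y z : Fin n} {e : EdgeType n} (he : e ∉ R) :
    phi R y z e = e := by
  unfold phi; rw [if_neg]; exact fun h => he h.1

lemma phi_inc {n : ℕ} {R : Finset (EdgeType n)} {y z w : Fin n} {e : EdgeType n}
    (hy : w ≠ y) (hz : w ≠ z) (hw : w ∈ e.1) : w ∈ (phi R y z e).1 := by
  unfold phi; split_ifs with h
  · have := mem_mapE (y := y) (z := z) hw
    rwa [Equiv.swap_apply_of_ne_of_ne hy hz] at this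
  · exact hw

lemma phi_y {n : ℕ} {R : Finset (EdgeType n)} {y z : Fin n} {e : EdgeType n}
    (hZ : ∀ e : EdgeType n, z ∈ e.1 → e ∈ R) (he : e ∈ R) (hy : y ∈ e.1) :
    z ∈ (phi R y z e).1 := by
  have h1 : z ∈ (mapE y z e).1 := by
    have := mem_mapE (y := y) (z := z) hy
    rwa [Equiv.swap_apply_left] at this
  rw [phi, if_pos ⟨he, hZ _ h1⟩]; exact h1

/-- unique strict maximum -/
def Top {n : ℕ} (R : Finset (EdgeType n)) (W : Finset (Fin n)) (v : Fin n) (σ : Ord n) : Prop :=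
  ∀ w ∈ W, w ≠ v → T R σ w < T R σ v

lemma top_map {n : ℕ} {R : Finset (EdgeType n)} {W : Finset (Fin n)} {y z : Fin n} {σ : Ord n}
    (hyW : y ∈ W) (hyz : y ≠ z) (hZ : ∀ e : EdgeType n, z ∈ e.1 → e ∈ R)
    (h : Top R W z σ) : Top R W y (σ.trans (phi_invol R y z).toPerm) := by
  have key : ∀ e, ((σ.trans (phi_invol R y z).toPerm).symm e) = σ.symm (phi R y z e) := by
    intro e; rfl
  have h1 : T R σ z ≤ T R (σ.trans (phi_invol R y z).toPerm) y := by
    apply le_T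
    intro e he hy
    rw [key]
    exact T_le (phi_mem he) (phi_y hZ he hy)
  intro w hw hwy
  refine lt_of_lt_of_le ?_ h1
  by_cases hwz : w = z
  · subst hwz
    obtain ⟨e, he, hye, hlt⟩ := T_lt (h y hyW hyz)
    refine lt_of_le_of_lt (T_le (phi_mem he) (phi_y hZ he hye)) ?_
    rw [key, phi_invol R y w e]; exact hlt
  · obtain ⟨e, he, hye, hlt⟩ := T_lt (h w hw hwz)
    refine lt_of_le_of_lt (T_le (phi_mem he) (phi_inc hwy hwz hye)) ?_
    rw [key, phi_invol R y z e]; exact hlt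

/-- the tie event -/
def Tie {n : ℕ} (R : Finset (EdgeType n)) (W : Finset (Fin n)) (z w : Fin n) (σ : Ord n) : Prop :=
  T R σ z = T R σ w ∧ ∀ x ∈ W, x ≠ z → x ≠ w → T R σ x < T R σ z

/-- the ordered event -/
def Ford {n : ℕ} (R : Finset (EdgeType n)) (W : Finset (Fin n)) (z w : Fin n) (σ : Ord n) : Prop :=
  T R σ z < T R σ w ∧ ∀ x ∈ W, x ≠ z → x ≠ w → T R σ x < T R σ z

lemma mem_mkE {n : ℕ} {v w x : Fin n} {h : v ≠ w} : x ∈ (mkE v w h).1 ↔ x = v ∨ x = w := by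
  simp [mkE]

lemma eq_mkE {n : ℕ} {v w : Fin n} (h : v ≠ w) {e : EdgeType n} (hv : v ∈ e.1) (hw : w ∈ e.1) :
    e = mkE v w h := by
  apply Subtype.ext
  exact (Sym2.mem_and_mem_iff h).1 ⟨hv, hw⟩

lemma T_ne_top {n : ℕ} {R : Finset (EdgeType n)} {σ : Ord n} {z w : Fin n} (h : z ≠ w)
    (hZ : ∀ e : EdgeType n, z ∈ e.1 → e ∈ R) : T R σ z ≠ ⊤ := by
  have hz : z ∈ (mkE z w h).1 := mem_mkE.2 (Or.inl rfl)
  exact ne_top_of_le_ne_top (ENat.natCast_ne_top _) (T_le (σ := σ) (hZ _ hz) hz)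

lemma tie_edge {n : ℕ} {R : Finset (EdgeType n)} {σ : Ord n} {z w : Fin n} (h : z ≠ w)
    (hZ : ∀ e : EdgeType n, z ∈ e.1 → e ∈ R) (ht : T R σ z = T R σ w) :
    T R σ z = ((σ.symm (mkE z w h) : ℕ) : ℕ∞) := by
  have h1 : T R σ z ≠ ⊤ := T_ne_top h hZ
  have h2 : T R σ w ≠ ⊤ := ht ▸ h1
  obtain ⟨e, he, hze, h3⟩ := T_attained h1
  obtain ⟨f, hf, hwf, h4⟩ := T_attained h2
  have hef : e = f := pos_inj (σ := σ) (by rw [← h3, ← h4, ht])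
  subst hef
  rw [h3, eq_mkE h hze hwf]

lemma tie_map {n : ℕ} {R : Finset (EdgeType n)} {W : Finset (Fin n)} {z w x : Fin n} {σ : Ord n}
    (h : z ≠ w) (hx : z ≠ x) (hxw : x ≠ w) (hZ : ∀ e : EdgeType n, z ∈ e.1 → e ∈ R)
    (ht : Tie R W z w σ) :
    Ford R W z w (σ.trans (Equiv.swap (mkE z w h) (mkE z x hx))) ∧
    T R (σ.trans (Equiv.swap (mkE z w h) (mkE z x hx))) z =
      (((σ.trans (Equiv.swap (mkE z w h) (mkE z x hx))).symm (mkE z x hx) : ℕ) : ℕ∞) := by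
  set φ := Equiv.swap (mkE z w h) (mkE z x hx) with hφ
  have key : ∀ e, ((σ.trans φ).symm e) = σ.symm (φ e) := by
    intro e; simp [hφ]
  have hT := tie_edge h hZ ht.1
  have hmz : z ∈ (mkE z w h).1 := mem_mkE.2 (Or.inl rfl)
  have hmx : z ∈ (mkE z x hx).1 := mem_mkE.2 (Or.inl rfl)
  have hne : mkE z x hx ≠ mkE z w h := by
    intro he
    have : x ∈ (mkE z w h).1 := he ▸ mem_mkE.2 (Or.inr rfl)
    rcases mem_mkE.1 this with h1 | h1
    · exact hx h1.symm
    · exact hxw h1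
  have hzz : T R (σ.trans φ) z = T R σ z := by
    apply le_antisymm
    · rw [hT]
      refine (T_le (hZ _ hmx) hmx).trans ?_
      rw [key, hφ, Equiv.swap_apply_right]
    · apply le_T
      intro e he hze
      rw [key]
      have : z ∈ (φ e).1 := by
        rw [hφ, Equiv.swap_apply_def]
        split_ifs
        · exact hmx
        · exact hmz
        · exact hze
      exact T_le (hZ _ this) this
  refine ⟨⟨?_, ?_⟩, ?_⟩
  · rw [hzz]
    by_contra hcon
    push Not at hcon
    obtain ⟨e, he, hwe, h5⟩ := T_attained (R := R) (σ := σ.trans φ) (v := w)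
      (ne_top_of_le_ne_top (T_ne_top h hZ) hcon)
    rw [h5, key] at hcon
    by_cases hezw : e = mkE z w h
    · rw [hezw, hφ, Equiv.swap_apply_left] at hcon
      have h6 : T R σ z = _ := le_antisymm (T_le (σ := σ) (hZ _ hmx) hmx) hcon
      exact hne (pos_inj (σ := σ) (h6.symm.trans hT))
    · have hezx : e ≠ mkE z x hx := by
        intro h7
        rw [h7] at hwe
        rcases mem_mkE.1 hwe with h8 | h8
        · exact h h8.symm
        · exact hxw h8.symm
      rw [hφ, Equiv.swap_apply_of_ne_of_ne hezw hezx] at hcon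
      have h6 : T R σ z = _ := le_antisymm (ht.1.le.trans (T_le (σ := σ) he hwe)) hcon
      exact hezw (pos_inj (σ := σ) (h6.symm.trans hT))
  · intro u hu huz huw
    rw [hzz]
    obtain ⟨e, he, hue, hlt⟩ := T_lt (ht.2 u hu huz huw)
    refine lt_of_le_of_lt (T_le he hue) ?_
    have hze : z ∉ e.1 := fun hz => absurd (T_le (σ := σ) he hz) (not_le.2 hlt)
    rw [key, hφ, Equiv.swap_apply_of_ne_of_ne]
    · exact hlt
    · rintro rfl; exact hze hmz
    · rintro rfl; exact hze hmx
  · rw [hzz, hT, key, hφ, Equiv.swap_apply_right]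

/-- the good event -/
def Good {n : ℕ} (R : Finset (EdgeType n)) (Y Z : Finset (Fin n)) (σ : Ord n) : Prop :=
  ∃ y ∈ Y, ∀ z ∈ Z, T R σ z < T R σ y

lemma cover {n : ℕ} {R : Finset (EdgeType n)} {Y Z : Finset (Fin n)} {σ : Ord n}
    (hne : (Y ∪ Z).Nonempty)
    (hZ : ∀ z ∈ Z, ∀ e : EdgeType n, z ∈ e.1 → e ∈ R) (hg : ¬ Good R Y Z σ) :
    (∃ z ∈ Z, Top R (Y ∪ Z) z σ) ∨ ∃ z ∈ Z, ∃ w ∈ Y ∪ Z, z ≠ w ∧ Tie R (Y ∪ Z) z w σ := by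
  obtain ⟨v, hv, hmax⟩ := Finset.exists_max_image (Y ∪ Z) (T R σ) hne
  have : ∃ z ∈ Z, ∀ u ∈ Y ∪ Z, T R σ u ≤ T R σ z := by
    rcases Finset.mem_union.1 hv with hvY | hvZ
    · unfold Good at hg
      push Not at hg
      obtain ⟨z, hz, hvz⟩ := hg v hvY
      exact ⟨z, hz, fun u hu => (hmax u hu).trans hvz⟩
    · exact ⟨v, hvZ, hmax⟩
  obtain ⟨z, hz, hzm⟩ := this
  by_cases ht : Top R (Y ∪ Z) z σ
  · exact Or.inl ⟨z, hz, ht⟩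
  right
  unfold Top at ht
  push Not at ht
  obtain ⟨w, hw, hwz, hle⟩ := ht
  have heq : T R σ z = T R σ w := le_antisymm hle (hzm w hw)
  refine ⟨z, hz, w, hw, hwz.symm, heq, fun x hx hxz hxw => lt_of_le_of_ne (hzm x hx) ?_⟩
  intro hxe
  have h1 := tie_edge hwz.symm (hZ z hz) heq
  have h2 := tie_edge hxz.symm (hZ z hz) hxe.symm
  have h3 := pos_inj (h1.symm.trans h2)
  have : x ∈ (mkE z w hwz.symm).1 := h3 ▸ mem_mkE.2 (Or.inr rfl)
  rcases mem_mkE.1 this with h | h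
  · exact hxz h
  · exact hxw h

lemma top_unique {n : ℕ} {R : Finset (EdgeType n)} {W : Finset (Fin n)} {v w : Fin n} {σ : Ord n}
    (hv : v ∈ W) (hw : w ∈ W) (h1 : Top R W v σ) (h2 : Top R W w σ) : v = w := by
  by_contra hne
  exact lt_asymm (h1 w hw (Ne.symm hne)) (h2 v hv hne)

lemma ford_top {n : ℕ} {R : Finset (EdgeType n)} {W : Finset (Fin n)} {z w : Fin n} {σ : Ord n}
    (h : Ford R W z w σ) : Top R W w σ := by
  intro x hx hxw
  by_cases hxz : x = z
  · rw [hxz]; exact h.1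
  · exact (h.2 x hx hxz hxw).trans h.1

lemma ford_unique {n : ℕ} {R : Finset (EdgeType n)} {W : Finset (Fin n)} {z w z' w' : Fin n}
    {σ : Ord n} (hz : z ∈ W) (hw : w ∈ W) (hz' : z' ∈ W) (hw' : w' ∈ W)
    (hzw : z ≠ w) (hzw' : z' ≠ w')
    (h1 : Ford R W z w σ) (h2 : Ford R W z' w' σ) : z = z' ∧ w = w' := by
  have h := top_unique hw hw' (ford_top h1) (ford_top h2)
  subst h
  refine ⟨?_, rfl⟩
  by_contra hne
  exact lt_asymm (h1.2 z' hz' (Ne.symm hne) hzw') (h2.2 z hz hne hzw)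

open scoped Classical in
lemma counting {n : ℕ} (hn : 3 ≤ n) {R : Finset (EdgeType n)} {Y Z : Finset (Fin n)}
    (hne : (Y ∪ Z).Nonempty) (hd : Disjoint Y Z)
    (hZ : ∀ z ∈ Z, ∀ e : EdgeType n, z ∈ e.1 → e ∈ R)
    (Ω : Finset (Ord n))
    (hΩ : ∀ σ ∈ Ω, ∀ φ : Equiv.Perm (EdgeType n), (∀ e, e ∉ R → φ e = e) → σ.trans φ ∈ Ω) :
    (1 - 1 / ((n : ℝ) - 2)) * (Y.card : ℝ) * (Ω.card : ℝ) ≤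
      ((Y.card : ℝ) + Z.card) * ((Ω.filter (Good R Y Z)).card : ℝ) := by
  set W := Y ∪ Z with hW
  set P := (Z ×ˢ W).filter (fun p => p.1 ≠ p.2) with hP
  have hPm : ∀ p ∈ P, p.1 ∈ Z ∧ p.1 ∈ W ∧ p.2 ∈ W ∧ p.1 ≠ p.2 := by
    intro p hp
    simp only [hP, Finset.mem_filter, Finset.mem_product] at hp
    exact ⟨hp.1.1, Finset.mem_union_right _ hp.1.1, hp.1.2, hp.2⟩
  -- step 1
  have s1 : ∀ y ∈ Y, ∀ z ∈ Z, (Ω.filter (Top R W z)).card ≤ (Ω.filter (Top R W y)).card := by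
    intro y hy z hz
    have hyz : y ≠ z := fun h => (Finset.disjoint_left.1 hd hy) (h ▸ hz)
    apply Finset.card_le_card_of_injOn (fun σ => σ.trans (phi_invol R y z).toPerm)
    · intro σ hσ
      have hσ := Finset.mem_filter.1 (Finset.mem_coe.1 hσ)
      refine Finset.mem_coe.2 (Finset.mem_filter.2 ⟨hΩ σ hσ.1 _ fun e he => phi_not_mem he, ?_⟩)
      exact top_map (Finset.mem_union_left _ hy) hyz (hZ z hz) hσ.2
    · intro σ _ σ' _ h
      ext1 i
      have := congrArg (fun f : Ord n => f i) h
      exact (phi_invol R y z).toPerm.injective this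
  have s2 : ∑ y ∈ Y, (Ω.filter (Top R W y)).card ≤ (Ω.filter (Good R Y Z)).card := by
    rw [← Finset.card_biUnion]
    · apply Finset.card_le_card
      intro σ hσ
      simp only [Finset.mem_biUnion, Finset.mem_filter] at hσ ⊢
      obtain ⟨y, hy, hσ, ht⟩ := hσ
      refine ⟨hσ, y, hy, fun z hz => ht z (Finset.mem_union_right _ hz) ?_⟩
      exact fun h => (Finset.disjoint_left.1 hd hy) (h ▸ hz)
    · intro a ha b hb hab
      rw [Function.onFun, Finset.disjoint_left]
      intro σ h1 h2
      exact hab (top_unique (Finset.mem_union_left _ ha) (Finset.mem_union_left _ hb)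
        (Finset.mem_filter.1 h1).2 (Finset.mem_filter.1 h2).2)
  have s3 : Ω.card ≤ (Ω.filter (Good R Y Z)).card + ∑ z ∈ Z, (Ω.filter (Top R W z)).card
      + ∑ p ∈ P, (Ω.filter (Tie R W p.1 p.2)).card := by
    have hsub : Ω ⊆ (Ω.filter (Good R Y Z)) ∪ (Z.biUnion fun z => Ω.filter (Top R W z))
        ∪ (P.biUnion fun p => Ω.filter (Tie R W p.1 p.2)) := by
      intro σ hσ
      by_cases hg : Good R Y Z σ
      · exact Finset.mem_union_left _ (Finset.mem_union_left _ (Finset.mem_filter.2 ⟨hσ, hg⟩))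
      rcases cover hne hZ hg with ⟨z, hz, h⟩ | ⟨z, hz, w, hw, hzw, h⟩
      · exact Finset.mem_union_left _ (Finset.mem_union_right _
          (Finset.mem_biUnion.2 ⟨z, hz, Finset.mem_filter.2 ⟨hσ, h⟩⟩))
      · refine Finset.mem_union_right _ (Finset.mem_biUnion.2 ⟨(z, w), ?_,
          Finset.mem_filter.2 ⟨hσ, h⟩⟩)
        simp only [hP, Finset.mem_filter, Finset.mem_product]
        exact ⟨⟨hz, hw⟩, hzw⟩
    refine (Finset.card_le_card hsub).trans ((Finset.card_union_le _ _).trans ?_)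
    exact add_le_add ((Finset.card_union_le _ _).trans (add_le_add le_rfl Finset.card_biUnion_le))
      Finset.card_biUnion_le
  have s4 : ∀ p ∈ P, (Ω.filter (Tie R W p.1 p.2)).card * (n - 2) ≤
      (Ω.filter (Ford R W p.1 p.2)).card := by
    rintro ⟨z, w⟩ hp
    obtain ⟨hz, hzW, hwW, hzw⟩ := hPm _ hp
    simp only at hz hzW hwW hzw ⊢
    have hc : ((Finset.univ : Finset (Fin n)) \ {z, w}).card = n - 2 := by
      rw [Finset.card_sdiff_of_subset (Finset.subset_univ _), Finset.card_pair hzw]; simp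
    rw [← hc, ← Finset.card_product]
    apply Finset.card_le_card_of_injOn (fun q => if h : z ≠ q.2 then
      q.1.trans (Equiv.swap (mkE z w hzw) (mkE z q.2 h)) else q.1)
    · rintro ⟨σ, x⟩ hq
      have hq := Finset.mem_coe.1 hq
      simp only [Finset.mem_product, Finset.mem_filter, Finset.mem_sdiff, Finset.mem_univ,
        Finset.mem_insert, Finset.mem_singleton, true_and, not_or] at hq
      obtain ⟨⟨hσ, ht⟩, hxz, hxw⟩ := hq
      have hzx : z ≠ x := Ne.symm hxz
      simp only [hzx, ne_eq, not_false_eq_true, dite_true]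
      refine Finset.mem_coe.2 (Finset.mem_filter.2 ⟨hΩ σ hσ _ ?_,
        (tie_map hzw hzx hxw (hZ z hz) ht).1⟩)
      intro e he
      apply Equiv.swap_apply_of_ne_of_ne
      · rintro rfl; exact he (hZ z hz _ (mem_mkE.2 (Or.inl rfl)))
      · rintro rfl; exact he (hZ z hz _ (mem_mkE.2 (Or.inl rfl)))
    · rintro ⟨σ, x⟩ hq ⟨σ', x'⟩ hq' heq
      have hq := Finset.mem_coe.1 hq
      have hq' := Finset.mem_coe.1 hq'
      simp only [Finset.mem_product, Finset.mem_filter, Finset.mem_sdiff, Finset.mem_univ,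
        Finset.mem_insert, Finset.mem_singleton, true_and, not_or] at hq hq'
      obtain ⟨⟨hσ, ht⟩, hxz, hxw⟩ := hq
      obtain ⟨⟨hσ', ht'⟩, hxz', hxw'⟩ := hq'
      have hzx : z ≠ x := Ne.symm hxz
      have hzx' : z ≠ x' := Ne.symm hxz'
      simp only [hzx, hzx', ne_eq, not_false_eq_true, dite_true] at heq
      have e1 := (tie_map hzw hzx hxw (hZ z hz) ht).2
      have e2 := (tie_map hzw hzx' hxw' (hZ z hz) ht').2
      rw [← heq] at e2
      have e3 := pos_inj (e1.symm.trans e2)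
      have hxx : x = x' := by
        have : x ∈ (mkE z x' hzx').1 := e3 ▸ mem_mkE.2 (Or.inr rfl)
        rcases mem_mkE.1 this with h | h
        · exact absurd h hxz
        · exact h
      subst hxx
      have : σ = σ' := by
        ext1 i
        have := congrArg (fun f : Ord n => f i) heq
        exact (Equiv.swap _ _).injective this
      rw [this]
  have s5 : ∑ p ∈ P, (Ω.filter (Ford R W p.1 p.2)).card ≤ Ω.card := by
    rw [← Finset.card_biUnion]
    · apply Finset.card_le_card
      intro σ hσ
      simp only [Finset.mem_biUnion, Finset.mem_filter] at hσ
      obtain ⟨_, _, hσ, _⟩ := hσ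
      exact hσ
    · intro a ha b hb hab
      rw [Function.onFun, Finset.disjoint_left]
      intro σ h1 h2
      obtain ⟨_, ha1, ha2, ha3⟩ := hPm a ha
      obtain ⟨_, hb1, hb2, hb3⟩ := hPm b hb
      have := ford_unique ha1 ha2 hb1 hb2 ha3 hb3
        (Finset.mem_filter.1 h1).2 (Finset.mem_filter.1 h2).2
      exact hab (Prod.ext this.1 this.2)
  have s6 : (∑ p ∈ P, (Ω.filter (Tie R W p.1 p.2)).card) * (n - 2) ≤ Ω.card := by
    rw [Finset.sum_mul]
    exact (Finset.sum_le_sum s4).trans s5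
  have s7 : Y.card * ∑ z ∈ Z, (Ω.filter (Top R W z)).card ≤
      Z.card * (Ω.filter (Good R Y Z)).card := by
    refine le_trans ?_ (Nat.mul_le_mul_left _ s2)
    calc Y.card * ∑ z ∈ Z, (Ω.filter (Top R W z)).card
        = ∑ y ∈ Y, ∑ z ∈ Z, (Ω.filter (Top R W z)).card := by
          rw [Finset.sum_const, smul_eq_mul]
      _ ≤ ∑ y ∈ Y, ∑ z ∈ Z, (Ω.filter (Top R W y)).card :=
          Finset.sum_le_sum fun y hy => Finset.sum_le_sum fun z hz => s1 y hy z hz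
      _ = Z.card * ∑ y ∈ Y, (Ω.filter (Top R W y)).card := by
          rw [Finset.mul_sum]
          exact Finset.sum_congr rfl fun y _ => by rw [Finset.sum_const, smul_eq_mul]
  have hn2 : (0 : ℝ) < (n : ℝ) - 2 := by
    have : (3 : ℝ) ≤ n := by exact_mod_cast hn
    linarith
  have s6' : ((∑ p ∈ P, (Ω.filter (Tie R W p.1 p.2)).card : ℕ) : ℝ) ≤
      1 / ((n : ℝ) - 2) * Ω.card := by
    have : (((∑ p ∈ P, (Ω.filter (Tie R W p.1 p.2)).card) * (n - 2) : ℕ) : ℝ) ≤ Ω.card := by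
      exact_mod_cast s6
    rw [Nat.cast_mul, Nat.cast_sub (by omega)] at this
    rw [one_div, inv_mul_eq_div, le_div_iff₀ hn2]
    exact_mod_cast this
  have s3' : (Ω.card : ℝ) ≤ ((Ω.filter (Good R Y Z)).card : ℝ) +
      ((∑ z ∈ Z, (Ω.filter (Top R W z)).card : ℕ) : ℝ)
      + ((∑ p ∈ P, (Ω.filter (Tie R W p.1 p.2)).card : ℕ) : ℝ) := by exact_mod_cast s3
  have s7' : (Y.card : ℝ) * ((∑ z ∈ Z, (Ω.filter (Top R W z)).card : ℕ) : ℝ) ≤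
      Z.card * (Ω.filter (Good R Y Z)).card := by exact_mod_cast s7
  have hY : (0 : ℝ) ≤ Y.card := Nat.cast_nonneg _
  have := mul_le_mul_of_nonneg_left (s3'.trans (add_le_add le_rfl s6')) hY
  nlinarith

lemma mem_buy {n : ℕ} {st : Strategy n} {σ : Ord n} {s : ℕ} {e : Sym2 (Fin n)}
    (h : e ∈ buy st σ s) : ∃ i, ∃ hi : i < numEdges n, i < s ∧ e = (σ ⟨i, hi⟩).1 ∧
      st (prefixList σ (i + 1)) = true := by
  induction s with
  | zero => simp [buy] at h
  | succ s ih =>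
    unfold buy at h
    have fin : e ∈ buy st σ s → ∃ i, ∃ hi : i < numEdges n, i < s + 1 ∧ e = (σ ⟨i, hi⟩).1 ∧
      st (prefixList σ (i + 1)) = true := by
      intro h
      obtain ⟨i, hi, his, h1, h2⟩ := ih h
      exact ⟨i, hi, by omega, h1, h2⟩
    split_ifs at h with h1 h2
    · rcases Finset.mem_insert.1 h with h3 | h3
      · exact ⟨s, h1, by omega, h3, h2⟩
      · exact fin h3
    · exact fin h
    · exact fin h

lemma take_eq {n m : ℕ} (hmN : m ≤ numEdges n) (g : Fin m → EdgeType n) (σ : Ord n)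
    (h : ∀ i : Fin m, σ (Fin.castLE hmN i) = g i) (k : ℕ) (hk : k ≤ m) :
    (List.ofFn (fun i : Fin m => ((g i : EdgeType n) : Sym2 (Fin n)))).take k
      = prefixList σ k := by
  induction k with
  | zero => simp [prefixList]
  | succ k ih =>
    rw [List.take_add_one, ih (by omega)]
    unfold prefixList
    rw [List.range_succ, List.filterMap_append]
    congr 1
    have hkN : k < numEdges n := by omega
    have hkm : k < m := by omega
    have := h ⟨k, hkm⟩
    simp only [Fin.castLE_mk] at this
    simp [hkN, hkm, this]

lemma deg_zero {n : ℕ} {S : Finset (Sym2 (Fin n))} {v : Fin n} :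
    deg S v = 0 ↔ ∀ e ∈ S, v ∉ e := by
  simp [deg, Finset.filter_eq_empty_iff]

lemma deg_pos {n : ℕ} {S : Finset (Sym2 (Fin n))} {v : Fin n} :
    1 ≤ deg S v ↔ ∃ e ∈ S, v ∈ e := by
  rw [Nat.one_le_iff_ne_zero, Ne, deg_zero]; push Not; rfl

lemma good_bad {n m : ℕ} (hmN : m ≤ numEdges n) (st : Strategy n) (g : Fin m → EdgeType n)
    (σ : Ord n) (h : ∀ i : Fin m, σ (Fin.castLE hmN i) = g i)
    {L : List (Sym2 (Fin n))}
    (hL : L = List.ofFn (fun i : Fin m => ((g i : EdgeType n) : Sym2 (Fin n))))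
    {R : Finset (EdgeType n)} (hR : ∀ e, e ∈ R ↔ ∀ i, g i ≠ e)
    {Y Z : Finset (Fin n)} (hY : ∀ v ∈ Y, deg (buyList st L) v = 0)
    (hZ : ∀ v, v ∉ Z → 1 ≤ deg L.toFinset v) (hG : Good R Y Z σ) :
    ∃ v : Fin n, deg (buy st σ (tau 1 σ)) v = 0 := by
  obtain ⟨y, hy, hyz⟩ := hG
  -- positions of edges of R
  have hpos : ∀ e ∈ R, m ≤ (σ.symm e : ℕ) := by
    intro e he
    by_contra hc
    push Not at hc
    apply (hR e).1 he ⟨_, hc⟩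
    rw [← h]
    have : (Fin.castLE hmN ⟨(σ.symm e : ℕ), hc⟩) = σ.symm e := Fin.ext rfl
    rw [this]; simp
  have hposR : ∀ i (hi : i < numEdges n), m ≤ i → σ ⟨i, hi⟩ ∈ R := by
    intro i hi hmi
    rw [hR]
    intro j hj
    rw [← h] at hj
    have := congrArg Fin.val (σ.injective hj)
    simp at this
    omega
  refine ⟨y, deg_zero.2 ?_⟩
  intro e he hye
  obtain ⟨i, hi, hit, rfl, hst⟩ := mem_buy he
  by_cases him : i < m
  · -- purchased in the first m
    have htk := take_eq hmN g σ h (i + 1) (by omega)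
    rw [← hL] at htk
    apply deg_zero.1 (hY y hy) _ _ hye
    unfold buyList
    rw [List.mem_toFinset, List.mem_filterMap]
    refine ⟨i, ?_, ?_⟩
    · rw [List.mem_range, hL]; simpa using him
    · rw [htk, if_pos hst, hL]
      have := h ⟨i, him⟩
      simp only [Fin.castLE_mk] at this
      simp [him, this]
  · push Not at him
    have hTy : T R σ y ≤ (i : ℕ∞) := by
      have := T_le (σ := σ) (hposR i hi him) hye
      simpa using this
    -- all vertices touched at time i
    have : tau 1 σ ≤ i := by
      apply Nat.sInf_le
      intro v
      rw [deg_pos]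
      by_cases hv : v ∈ Z
      · obtain ⟨f, hf, hvf, hlt⟩ := T_lt ((hyz v hv).trans_le hTy)
        refine ⟨f.1, ?_, hvf⟩
        unfold procEdges
        rw [Finset.mem_image]
        refine ⟨σ.symm f, ?_, by simp⟩
        simp only [Finset.mem_filter, Finset.mem_univ, true_and]
        exact_mod_cast hlt
      · obtain ⟨f, hf, hvf⟩ := deg_pos.1 (hZ v hv)
        rw [hL, List.mem_toFinset, List.mem_ofFn] at hf
        obtain ⟨j, rfl⟩ := hf
        refine ⟨_, ?_, hvf⟩
        unfold procEdges
        rw [Finset.mem_image]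
        refine ⟨Fin.castLE hmN j, ?_, by rw [h]⟩
        simp only [Finset.mem_filter, Finset.mem_univ, true_and, Fin.val_castLE]
        omega
    omega

lemma card_edge (n : ℕ) : Fintype.card (EdgeType n) = numEdges n := by
  rw [Sym2.card_subtype_not_diag, Fintype.card_fin, Nat.choose_two_right]; rfl

lemma exists_ext {n m : ℕ} (hmN : m ≤ numEdges n) (g : Fin m → EdgeType n)
    (hg : Function.Injective g) : ∃ σ : Ord n, ∀ i : Fin m, σ (Fin.castLE hmN i) = g i := by
  classical
  let s : Finset (Fin (numEdges n)) := Finset.univ.map (Fin.castLEEmb hmN)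
  by_cases hm : m = 0
  · subst hm
    exact ⟨Fintype.equivOfCardEq (by rw [card_edge]; simp), fun i => i.elim0⟩
  let f : Fin (numEdges n) → EdgeType n := fun i =>
    if h : (i : ℕ) < m then g ⟨i, h⟩ else g ⟨0, by omega⟩
  have hf : ∀ i : Fin m, f (Fin.castLE hmN i) = g i := by
    intro i; simp [f]
  obtain ⟨e, he⟩ := Finset.exists_equiv_extend_of_card_eq (α := Fin (numEdges n))
    (t := (Finset.univ : Finset (EdgeType n))) (by rw [Finset.card_univ, card_edge]; simp)
    (s := s) (f := f) (Finset.subset_univ _) (by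
      intro a ha b hb hab
      simp only [s, Finset.coe_map, Finset.coe_univ, Set.image_univ, Set.mem_range] at ha hb
      obtain ⟨a, rfl⟩ := ha
      obtain ⟨b, rfl⟩ := hb
      simp only [Fin.castLEEmb_apply] at hab
      rw [hf, hf] at hab
      rw [hg hab])
  refine ⟨e.trans (Equiv.subtypeUnivEquiv (fun x => Finset.mem_univ x)), fun i => ?_⟩
  have := he (Fin.castLE hmN i) (by simp [s])
  rw [hf] at this
  simpa using this

/-- Let `C > 0`. For every `η > 0` there is `n₀` such that for all
`n ≥ n₀`, every `m ≤ Cn`, every deterministic online strategy, and every realization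
`g` of the first `m` edges with `Y_m ∪ Z_m ≠ ∅`, the conditional probability (given
`e_1, …, e_m`) that `B_{τ_1}` has an isolated vertex is at least
`(1 − η)·|Y_m| / (|Y_m| + |Z_m|)`. -/
theorem isolated_vertex_cond_prob (C : ℝ) (hC : 0 < C) (η : ℝ) (hη : 0 < η) :
    ∃ n₀ : ℕ, ∀ n : ℕ, n₀ ≤ n → ∀ m : ℕ, (m : ℝ) ≤ C * n → ∀ hmN : m ≤ numEdges n,
      ∀ st : Strategy n, ∀ g : Fin m → EdgeType n, Function.Injective g →
        letI L : List (Sym2 (Fin n)) := List.ofFn (fun i : Fin m => ((g i : EdgeType n) : Sym2 (Fin n)))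
        letI Ym : Finset (Fin n) := (Finset.univ : Finset (Fin n)).filter
          (fun v => deg (buyList st L) v = 0 ∧ 1 ≤ deg L.toFinset v)
        letI Zm : Finset (Fin n) := (Finset.univ : Finset (Fin n)).filter
          (fun v => deg L.toFinset v = 0)
        (Ym ∪ Zm).Nonempty →
        (1 - η) * (Ym.card : ℝ) / ((Ym.card : ℝ) + (Zm.card : ℝ)) ≤
          CondPr (fun σ => ∃ v : Fin n, deg (buy st σ (tau 1 σ)) v = 0)
            (fun σ => ∀ i : Fin m, σ (Fin.castLE hmN i) = g i) := by
  obtain ⟨k, hk⟩ := exists_nat_gt (1 / η)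
  refine ⟨k + 3, ?_⟩
  intro n hn m _ hmN st g hg
  intro hne
  set L : List (Sym2 (Fin n)) :=
    List.ofFn (fun i : Fin m => ((g i : EdgeType n) : Sym2 (Fin n))) with hL
  set Ym : Finset (Fin n) := (Finset.univ : Finset (Fin n)).filter
    (fun v => deg (buyList st L) v = 0 ∧ 1 ≤ deg L.toFinset v) with hYm
  set Zm : Finset (Fin n) := (Finset.univ : Finset (Fin n)).filter
    (fun v => deg L.toFinset v = 0) with hZm
  classical
  let R : Finset (EdgeType n) := Finset.univ.filter fun e => ∀ i, g i ≠ e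
  have hR : ∀ e, e ∈ R ↔ ∀ i, g i ≠ e := by intro e; simp [R]
  let q : Ord n → Prop := fun σ => ∀ i : Fin m, σ (Fin.castLE hmN i) = g i
  let p : Ord n → Prop := fun σ => ∃ v : Fin n, deg (buy st σ (tau 1 σ)) v = 0
  let Ω : Finset (Ord n) := Finset.univ.filter q
  have hcount := counting (n := n) (by omega) (R := R) (Y := Ym) (Z := Zm) hne ?_ ?_ Ω ?_
  · have hΩne : Ω.Nonempty := by
      obtain ⟨σ, hσ⟩ := exists_ext hmN g hg
      exact ⟨σ, Finset.mem_filter.2 ⟨Finset.mem_univ _, hσ⟩⟩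
    have hΩpos : (0 : ℝ) < Ω.card := by exact_mod_cast hΩne.card_pos
    have hall : (0 : ℝ) < Fintype.card (Ord n) := by
      obtain ⟨σ, _⟩ := hΩne
      exact_mod_cast Fintype.card_pos_iff.2 ⟨σ⟩
    have hle : (Ω.filter (Good R Ym Zm)).card ≤
        ((Finset.univ : Finset (Ord n)).filter (fun σ => p σ ∧ q σ)).card := by
      apply Finset.card_le_card
      intro σ hσ
      simp only [Ω, Finset.mem_filter, Finset.mem_univ, true_and] at hσ ⊢
      refine ⟨?_, hσ.1⟩
      refine good_bad hmN st g σ hσ.1 (L := L) rfl hR (Y := Ym) (Z := Zm) ?_ ?_ hσ.2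
      · intro v hv
        exact (Finset.mem_filter.1 hv).2.1
      · intro v hv
        by_contra hc
        exact hv (Finset.mem_filter.2 ⟨Finset.mem_univ _, by omega⟩)
    have hle' : ((Ω.filter (Good R Ym Zm)).card : ℝ) ≤
        (((Finset.univ : Finset (Ord n)).filter (fun σ => p σ ∧ q σ)).card : ℝ) := by
      exact_mod_cast hle
    have hcp : CondPr p q =
        (((Finset.univ : Finset (Ord n)).filter (fun σ => p σ ∧ q σ)).card : ℝ) / Ω.card := by
      unfold CondPr Pr
      rw [div_div_div_cancel_right₀ hall.ne']
      congr!
    change _ ≤ CondPr p q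
    rw [hcp]
    have hYZ : (0 : ℝ) < (Ym.card : ℝ) + Zm.card := by
      have h1 : 0 < (Ym ∪ Zm).card := hne.card_pos
      have h2 := Finset.card_union_le Ym Zm
      exact_mod_cast lt_of_lt_of_le h1 h2
    have hη' : 1 / ((n : ℝ) - 2) ≤ η := by
      have hn' : (k : ℝ) + 3 ≤ n := by exact_mod_cast hn
      have h0 : 0 < 1 / η := by positivity
      rw [div_le_iff₀ (by linarith)]
      rw [div_lt_iff₀ hη] at hk
      nlinarith
    rw [div_le_div_iff₀ hYZ hΩpos]
    have hY0 : (0 : ℝ) ≤ (Ym.card : ℝ) * Ω.card := by positivity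
    have h1 := mul_le_mul_of_nonneg_right hη' hY0
    have h2 := mul_le_mul_of_nonneg_left hle' hYZ.le
    linarith
  · rw [Finset.disjoint_left]
    intro v h1 h2
    have h3 := (Finset.mem_filter.1 h1).2.2
    have h4 := (Finset.mem_filter.1 h2).2
    omega
  · intro z hz e hze
    rw [hR]
    rintro i rfl
    refine deg_zero.1 (Finset.mem_filter.1 hz).2 (g i).1 ?_ hze
    rw [List.mem_toFinset, List.mem_ofFn]
    exact ⟨i, rfl⟩
  · intro σ hσ φ hφ
    simp only [Ω, q, Finset.mem_filter, Finset.mem_univ, true_and] at hσ ⊢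
    intro i
    rw [Equiv.trans_apply, hσ]
    apply hφ
    rw [hR]
    push Not
    exact ⟨i, rfl⟩

end RGP
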